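/- For every n and every d ≥ 1, the dual cone of the copositive tensor cone of dimension n+1 and order d equals the conic hull of the tensors M_d(y) with first coordinate of y equal to 0 or 1 and remaining coordinates nonnegative: {Y a symmetric tensor of dimension n+1 and order d : ⟨X, Y⟩ ≥ 0 for all symmetric X with ⟨X, M_d(y)⟩ ≥ 0 for all y ∈ ℝ^{n+1}, y ≥ 0} = {∑_{s} λ_s · M_d((1, u_s)) + ∑_{t} γ_t · M_d((0, v_t)) : finite families with λ_s ≥ 0, γ_t ≥ 0, u_s ∈ ℝⁿ, u_s ≥ 0, v_t ∈ ℝⁿ, v_t ≥ 0}. -/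

import Mathlib

/-- A tensor of dimension `n` and order `d` is symmetric if its entries are invariant under
permutations of its indices. -/
def IsSymmTensor {n d : ℕ} (T : (Fin d → Fin n) → ℝ) : Prop :=
  ∀ (σ : Equiv.Perm (Fin d)) (f : Fin d → Fin n), T (f ∘ σ) = T f

/-- The tensor inner product `⟨S, T⟩ = ∑ f, S f * T f`. -/
noncomputable def tenIP {n d : ℕ} (S T : (Fin d → Fin n) → ℝ) : ℝ :=
  ∑ f : Fin d → Fin n, S f * T f

/-- `M_d(x)`, the symmetric tensor with entries `M_d(x)(f) = ∏ j, x (f j)`. -/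
def tenM (n d : ℕ) (x : Fin n → ℝ) : (Fin d → Fin n) → ℝ := fun f => ∏ j : Fin d, x (f j)

open Finset

/-- In a finite-dimensional space the convex hull of a compact set is compact. -/
theorem IsCompact.convexHull_of_finiteDimensional {E : Type*} [NormedAddCommGroup E]
    [NormedSpace ℝ E] [FiniteDimensional ℝ E] {s : Set E} (hs : IsCompact s) :
    IsCompact (convexHull ℝ s) := by
  have key : convexHull ℝ s = ⋃ k ∈ Set.Iic (Module.finrank ℝ E + 1),
      (fun p : (Fin k → ℝ) × (Fin k → E) => ∑ i, p.1 i • p.2 i) ''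
        (stdSimplex ℝ (Fin k) ×ˢ Set.univ.pi fun _ => s) := by
    ext x
    simp only [Set.mem_iUnion, Set.mem_image, Set.mem_prod, Set.mem_univ_pi, exists_prop,
      Set.mem_Iic, Prod.exists]
    constructor
    · intro hx
      obtain ⟨ι, _, z, w, hz, haff, hw, hw1, rfl⟩ := eq_pos_convex_span_of_mem_convexHull hx
      let e := Fintype.equivFin ι
      refine ⟨Fintype.card ι, ?_, w ∘ e.symm, z ∘ e.symm,
        ⟨⟨fun i => (hw _).le, ?_⟩, fun i => ?_⟩, ?_⟩
      · exact haff.card_le_finrank_succ.trans (by gcongr; exact Submodule.finrank_le _)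
      · rw [← hw1]; exact e.symm.sum_comp w
      · exact hz ⟨_, rfl⟩
      · exact e.symm.sum_comp fun i => w i • z i
    · rintro ⟨k, -, w, z, ⟨⟨hw, hw1⟩, hz⟩, rfl⟩
      exact mem_convexHull_of_exists_fintype w z hw hw1 hz rfl
  rw [key]
  refine (Set.finite_Iic _).isCompact_biUnion fun k _ => ?_
  refine ((isCompact_stdSimplex ℝ _).prod (isCompact_univ_pi fun _ => hs)).image ?_
  fun_prop

theorem isSymmTensor_tenM (n d : ℕ) (y : Fin n → ℝ) : IsSymmTensor (tenM n d y) :=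
  fun σ f => Equiv.prod_comp σ fun j => y (f j)

theorem tenM_nonneg {n d : ℕ} {y : Fin n → ℝ} (hy : ∀ i, 0 ≤ y i) (f : Fin d → Fin n) :
    0 ≤ tenM n d y f :=
  prod_nonneg fun _ _ => hy _

theorem tenM_smul (n d : ℕ) (c : ℝ) (y : Fin n → ℝ) :
    tenM n d (c • y) = c ^ d • tenM n d y := by
  ext f
  simp [tenM, prod_mul_distrib]

theorem sum_tenM (n d : ℕ) (y : Fin n → ℝ) : ∑ f, tenM n d y f = (∑ i, y i) ^ d :=
  (sum_pow' (univ : Finset (Fin n)) y d).symm ▸ by simp [tenM]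

theorem continuous_tenM (n d : ℕ) : Continuous (tenM n d) := by
  unfold tenM
  fun_prop

theorem tenIP_add_right {n d : ℕ} (X Y Z : (Fin d → Fin n) → ℝ) :
    tenIP X (Y + Z) = tenIP X Y + tenIP X Z :=
  dotProduct_add X Y Z

theorem tenIP_sum_smul {n d : ℕ} {ι : Type*} [Fintype ι] (X : (Fin d → Fin n) → ℝ)
    (c : ι → ℝ) (Y : ι → (Fin d → Fin n) → ℝ) :
    tenIP X (∑ i, c i • Y i) = ∑ i, c i * tenIP X (Y i) := by
  change X ⬝ᵥ _ = ∑ i, c i * (X ⬝ᵥ Y i)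
  simp [dotProduct_sum]

theorem sum_perm_isSymmTensor {n d : ℕ} (X : (Fin d → Fin n) → ℝ) :
    IsSymmTensor fun f => ∑ σ : Equiv.Perm (Fin d), X (f ∘ σ) := fun τ f =>
  Equiv.sum_comp (Equiv.mulLeft τ) fun σ : Equiv.Perm (Fin d) => X (f ∘ σ)

theorem tenIP_sum_perm {n d : ℕ} (X : (Fin d → Fin n) → ℝ) {Y : (Fin d → Fin n) → ℝ}
    (hY : IsSymmTensor Y) :
    tenIP (fun f => ∑ σ : Equiv.Perm (Fin d), X (f ∘ σ)) Y = (d.factorial : ℝ) * tenIP X Y := by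
  have h (σ : Equiv.Perm (Fin d)) : ∑ f : Fin d → Fin n, X (f ∘ σ) * Y f = tenIP X Y := by
    rw [tenIP, ← (Equiv.arrowCongr σ.symm (Equiv.refl (Fin n))).sum_comp fun f => X f * Y f]
    refine sum_congr rfl fun f _ => ?_
    have : (Equiv.arrowCongr σ.symm (Equiv.refl (Fin n))) f = f ∘ σ := rfl
    rw [this, hY]
  simp only [tenIP, sum_mul]
  rw [sum_comm]
  simp [h, Fintype.card_perm, tenIP]

/-- A symmetric tensor in the dual of the copositive cone pairs nonnegatively with every tensor,
symmetric or not, that is nonnegative on all `M_d(y)` with `y ≥ 0`. -/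
theorem tenIP_nonneg_of_mem_dual {n d : ℕ} {Y : (Fin d → Fin n) → ℝ} (hY : IsSymmTensor Y)
    (hdual : ∀ X : (Fin d → Fin n) → ℝ, IsSymmTensor X →
      (∀ y : Fin n → ℝ, (∀ i, 0 ≤ y i) → 0 ≤ tenIP X (tenM n d y)) → 0 ≤ tenIP X Y)
    {X : (Fin d → Fin n) → ℝ}
    (hX : ∀ y : Fin n → ℝ, (∀ i, 0 ≤ y i) → 0 ≤ tenIP X (tenM n d y)) : 0 ≤ tenIP X Y := by
  have h := hdual _ (sum_perm_isSymmTensor X) fun y hy => by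
    rw [tenIP_sum_perm X (isSymmTensor_tenM n d y)]
    exact mul_nonneg (Nat.cast_nonneg _) (hX y hy)
  rw [tenIP_sum_perm X hY] at h
  exact nonneg_of_mul_nonneg_right h (by exact_mod_cast d.factorial_pos)

/-- Nonnegativity on the standard simplex extends to the nonnegative orthant by homogeneity. -/
theorem tenIP_tenM_nonneg_of_stdSimplex {n d : ℕ} (hd : 1 ≤ d) {X : (Fin d → Fin n) → ℝ}
    (hX : ∀ y ∈ stdSimplex ℝ (Fin n), 0 ≤ tenIP X (tenM n d y))
    {y : Fin n → ℝ} (hy : ∀ i, 0 ≤ y i) : 0 ≤ tenIP X (tenM n d y) := by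
  obtain h0 | hpos := (sum_nonneg fun i (_ : i ∈ univ) => hy i).eq_or_lt'
  · have : tenM n d y = 0 := by
      have hz : y = (0 : ℝ) • y := by
        ext i
        simpa using (sum_eq_zero_iff_of_nonneg fun i _ => hy i).1 h0 i (mem_univ i)
      rw [hz, tenM_smul, zero_pow (by omega), zero_smul]
    simp [this, tenIP]
  · have hz : y = (∑ i, y i) • (∑ i, y i)⁻¹ • y := by
      rw [smul_smul, mul_inv_cancel₀ hpos.ne', one_smul]
    have hmem : (∑ i, y i)⁻¹ • y ∈ stdSimplex ℝ (Fin n) :=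
      ⟨fun i => mul_nonneg (inv_nonneg.2 hpos.le) (hy i), by
        simp [← mul_sum, inv_mul_cancel₀ hpos.ne']⟩
    rw [hz, tenM_smul]
    change 0 ≤ X ⬝ᵥ _
    rw [dotProduct_smul]
    exact mul_nonneg (pow_nonneg hpos.le _) (hX _ hmem)

/-- Every symmetric tensor in the dual of the copositive cone is a finite conic combination of
tensors `M_d(y)` with `y ≥ 0`. -/
theorem exists_eq_sum_smul_tenM_of_mem_dual {n d : ℕ} (hd : 1 ≤ d)
    {Y : (Fin d → Fin n) → ℝ} (hY : IsSymmTensor Y)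
    (hdual : ∀ X : (Fin d → Fin n) → ℝ, IsSymmTensor X →
      (∀ y : Fin n → ℝ, (∀ i, 0 ≤ y i) → 0 ≤ tenIP X (tenM n d y)) → 0 ≤ tenIP X Y) :
    ∃ (m : ℕ) (c : Fin m → ℝ) (y : Fin m → Fin n → ℝ),
      (∀ i, 0 ≤ c i) ∧ (∀ i j, 0 ≤ y i j) ∧ Y = ∑ i, c i • tenM n d (y i) := by
  have hYf (f : Fin d → Fin n) : 0 ≤ Y f := by
    have h := tenIP_nonneg_of_mem_dual hY hdual (X := Pi.single f 1) fun y hy => by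
      simpa [tenIP, Pi.single_apply] using tenM_nonneg hy f
    simpa [tenIP, Pi.single_apply] using h
  obtain h0 | hpos := (sum_nonneg fun f (_ : f ∈ univ) => hYf f).eq_or_lt'
  · refine ⟨0, 0, 0, by simp, by simp, ?_⟩
    ext f
    simpa using (sum_eq_zero_iff_of_nonneg fun f _ => hYf f).1 h0 f (mem_univ f)
  set K := convexHull ℝ (tenM n d '' stdSimplex ℝ (Fin n))
  have hKc : IsCompact K :=
    ((isCompact_stdSimplex ℝ _).image (continuous_tenM n d)).convexHull_of_finiteDimensional
  have hmem : (∑ f, Y f)⁻¹ • Y ∈ K := by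
    by_contra hnot
    obtain ⟨φ, a, hφY, hφK⟩ :=
      geometric_hahn_banach_point_closed (convex_convexHull ℝ _) hKc.isClosed hnot
    let X : (Fin d → Fin n) → ℝ := fun f => φ (Pi.single f 1) - a
    have hX (T : (Fin d → Fin n) → ℝ) : tenIP X T = φ T - a * ∑ f, T f := by
      have : φ T = ∑ f, T f * φ (Pi.single f 1) := by
        conv_lhs => rw [pi_eq_sum_univ' T]
        simp [map_sum]
      simp only [tenIP, X, sub_mul, sum_sub_distrib, this, mul_sum]
      simp only [mul_comm]
    have h := tenIP_nonneg_of_mem_dual hY hdual (X := X) fun y hy =>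
      tenIP_tenM_nonneg_of_stdSimplex hd (fun z hz => by
        rw [hX, sum_tenM, hz.2, one_pow, mul_one, sub_nonneg]
        exact (hφK _ (subset_convexHull ℝ _ ⟨z, hz, rfl⟩)).le) hy
    rw [hX] at h
    rw [map_smul, smul_eq_mul, inv_mul_lt_iff₀ hpos] at hφY
    linarith
  obtain ⟨ι, _, w, z, hw, -, hz, hsum⟩ := mem_convexHull_iff_exists_fintype.1 hmem
  choose y hy hyz using hz
  let e := (Fintype.equivFin ι).symm
  refine ⟨Fintype.card ι, fun i => (∑ f, Y f) * w (e i), fun i => y (e i),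
    fun i => mul_nonneg hpos.le (hw _), fun i => (hy _).1, ?_⟩
  rw [e.sum_comp fun i => ((∑ f, Y f) * w i) • tenM n d (y i)]
  simp only [hyz, mul_smul, ← smul_sum, hsum]
  rw [smul_smul, mul_inv_cancel₀ hpos.ne', one_smul]

/-- for `d ≥ 1`, the dual cone (within symmetric tensors) of the copositive
tensor cone of dimension `n + 1` and order `d` equals the conic hull of the tensors
`M_d((1, u))` with `u ≥ 0` and `M_d((0, v))` with `v ≥ 0`. -/
theorem dual_copositive_eq_conicHull (n d : ℕ) (hd : 1 ≤ d) :
    {Y : (Fin d → Fin (n + 1)) → ℝ | IsSymmTensor Y ∧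
        ∀ X : (Fin d → Fin (n + 1)) → ℝ, IsSymmTensor X →
          (∀ y : Fin (n + 1) → ℝ, (∀ i, 0 ≤ y i) → 0 ≤ tenIP X (tenM (n + 1) d y)) →
          0 ≤ tenIP X Y} =
      {Y : (Fin d → Fin (n + 1)) → ℝ |
        ∃ (N₁ N₀ : ℕ) (lam : Fin N₁ → ℝ) (u : Fin N₁ → (Fin n → ℝ))
          (gam : Fin N₀ → ℝ) (v : Fin N₀ → (Fin n → ℝ)),
          (∀ s, 0 ≤ lam s) ∧ (∀ s i, 0 ≤ u s i) ∧
          (∀ t, 0 ≤ gam t) ∧ (∀ t i, 0 ≤ v t i) ∧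
          Y = fun f => (∑ s, lam s * tenM (n + 1) d (Fin.cons 1 (u s)) f) +
            ∑ t, gam t * tenM (n + 1) d (Fin.cons 0 (v t)) f} := by
  ext Y
  constructor
  · rintro ⟨hY, hdual⟩
    obtain ⟨m, c, y, hc, hy, rfl⟩ := exists_eq_sum_smul_tenM_of_mem_dual hd hY hdual
    refine ⟨m, m, fun i => c i * y i 0 ^ d, fun i => (y i 0)⁻¹ • Fin.tail (y i),
      fun i => if y i 0 = 0 then c i else 0, fun i => Fin.tail (y i),
      fun i => mul_nonneg (hc i) (pow_nonneg (hy i 0) d),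
      fun i j => mul_nonneg (inv_nonneg.2 (hy i 0)) (hy i _),
      fun i => by dsimp only; split_ifs <;> simp [hc], fun i j => hy i _, ?_⟩
    ext f
    rw [← sum_add_distrib, Finset.sum_apply]
    refine sum_congr rfl fun i _ => ?_
    obtain h0 | h0 := eq_or_ne (y i 0) 0
    · have hcons : (Fin.cons 0 (Fin.tail (y i)) : Fin (n + 1) → ℝ) = y i := by
        rw [← h0, Fin.cons_self_tail]
      simp [h0, hcons, zero_pow (show d ≠ 0 by omega)]
    · have hcons : y i = y i 0 • (Fin.cons 1 ((y i 0)⁻¹ • Fin.tail (y i)) : Fin (n + 1) → ℝ) := by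
        ext j
        refine Fin.cases ?_ (fun k => ?_) j
        · simp
        · simp [Fin.tail, h0]
      have hM := congrFun (tenM_smul (n + 1) d (y i 0)
        (Fin.cons 1 ((y i 0)⁻¹ • Fin.tail (y i)))) f
      rw [← hcons] at hM
      simp [h0, hM, mul_assoc]
  · rintro ⟨N₁, N₀, lam, u, gam, v, hlam, hu, hgam, hv, hYeq⟩
    have hY : Y = ∑ s, lam s • tenM (n + 1) d (Fin.cons 1 (u s)) +
        ∑ t, gam t • tenM (n + 1) d (Fin.cons 0 (v t)) := by
      rw [hYeq]
      ext f
      simp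
    refine ⟨fun σ f => ?_, fun X _ hX => ?_⟩
    · simp only [hYeq, isSymmTensor_tenM (n + 1) d _ σ f]
    · rw [hY, tenIP_add_right, tenIP_sum_smul, tenIP_sum_smul]
      refine add_nonneg (sum_nonneg fun s _ => mul_nonneg (hlam s) (hX _ ?_))
        (sum_nonneg fun t _ => mul_nonneg (hgam t) (hX _ ?_))
      · exact Fin.cases zero_le_one (hu s)
      · exact Fin.cases le_rfl (hv t)
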